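/- Let G be a directed polymatroidal network and let z ∈ ℝ≥0^{V∪E} with ∑_{v∈V} deg_v z_v² > 0. Then [∑_{v∈V}(ρ̂⁺_v((max{0, z_v² − z_e²})_{e∈δ⁺(v)}) + ρ̂⁻_v((max{0, z_e² − z_v²})_{e∈δ⁻(v)}))] / ∑_{v∈V} deg_v z_v² ≤ 8·(R⁺(z) + √(R⁺(z))), and analogously [∑_{v∈V}(ρ̂⁺_v((max{0, z_e² − z_v²})_{e∈δ⁺(v)}) + ρ̂⁻_v((max{0, z_v² − z_e²})_{e∈δ⁻(v)}))] / ∑_{v∈V} deg_v z_v² ≤ 8·(R⁻(z) + √(R⁻(z))). -/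

import Mathlib

open MeasureTheory

/-- Lovász extension of the set function `f`, with ground set `D`,
evaluated at the (nonnegative) vector `x`. -/
noncomputable def lovOn {E : Type*} (f : Set E → ℝ) (D : Set E) (x : E → ℝ) : ℝ :=
  ∫ θ in Set.Ioi (0 : ℝ), f (D ∩ {e | θ ≤ x e})

/-- A directed polymatroidal network on vertex type `V` and edge type `E`. -/
structure PolyNet (V E : Type*) [Fintype V] [Fintype E] where
  tail : E → V
  head : E → V
  w : V → ℝ
  w_nonneg : ∀ v, 0 ≤ w v
  ρp : V → Set E → ℝ
  ρm : V → Set E → ℝ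
  ρp_nonneg : ∀ v A, 0 ≤ ρp v A
  ρm_nonneg : ∀ v A, 0 ≤ ρm v A
  ρp_empty : ∀ v, ρp v ∅ = 0
  ρm_empty : ∀ v, ρm v ∅ = 0
  ρp_mono : ∀ v A B, A ⊆ B → B ⊆ {e | tail e = v} → ρp v A ≤ ρp v B
  ρm_mono : ∀ v A B, A ⊆ B → B ⊆ {e | head e = v} → ρm v A ≤ ρm v B
  ρp_submod : ∀ v A B, A ⊆ {e | tail e = v} → B ⊆ {e | tail e = v} →
    ρp v (A ∪ B) + ρp v (A ∩ B) ≤ ρp v A + ρp v B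
  ρm_submod : ∀ v A B, A ⊆ {e | head e = v} → B ⊆ {e | head e = v} →
    ρm v (A ∪ B) + ρm v (A ∩ B) ≤ ρm v A + ρm v B

namespace PolyNet

variable {V E : Type*} [Fintype V] [Fintype E] (N : PolyNet V E)

/-- The set of edges leaving `v`. -/
def outE (v : V) : Set E := {e | N.tail e = v}

/-- The set of edges entering `v`. -/
def inE (v : V) : Set E := {e | N.head e = v}

/-- The degree of a vertex. -/
noncomputable def deg (v : V) : ℝ := N.ρp v (N.outE v) + N.ρm v (N.inE v)

/-- The volume of a set of vertices. -/
noncomputable def vol (S : Set V) : ℝ := ∑ v, S.indicator N.deg v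

/-- The total weight of a set of vertices. -/
noncomputable def wsum (S : Set V) : ℝ := ∑ v, S.indicator N.w v

/-- An assignment `g` of (cut) edges to vertices is valid on `F` if every edge of `F` is
assigned to one of its endpoints. -/
def valid (F : Set E) (g : E → V) : Prop := ∀ e ∈ F, g e = N.tail e ∨ g e = N.head e

/-- The cost of the cut `F` under the assignment `g`. -/
noncomputable def cutCost (F : Set E) (g : E → V) : ℝ :=
  ∑ v, (N.ρp v (N.outE v ∩ F ∩ {e | g e = v}) + N.ρm v (N.inE v ∩ F ∩ {e | g e = v}))

/-- The cost of the cut `F`: minimum over valid assignments. -/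
noncomputable def cut (F : Set E) : ℝ :=
  sInf {c | ∃ g : E → V, N.valid F g ∧ c = N.cutCost F g}

/-- Edges from `S` to its complement. -/
def dplus (S : Set V) : Set E := {e | N.tail e ∈ S ∧ N.head e ∉ S}

/-- Edges from the complement of `S` into `S`. -/
def dminus (S : Set V) : Set E := {e | N.tail e ∉ S ∧ N.head e ∈ S}

/-- The (directed) value of the cut induced by `S`. -/
noncomputable def cutval (S : Set V) : ℝ := min (N.cut (N.dplus S)) (N.cut (N.dminus S))

/-- The symmetric value of the cut induced by `S`. -/
noncomputable def symcutval (S : Set V) : ℝ := N.cut (N.dplus S) + N.cut (N.dminus S)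

/-- The Rayleigh quotient `R⁺`. -/
noncomputable def Rp (x : V ⊕ E → ℝ) : ℝ :=
  (∑ v, (lovOn (N.ρp v) (N.outE v) (fun e => (max 0 (x (Sum.inl v) - x (Sum.inr e)))^2)
       + lovOn (N.ρm v) (N.inE v) (fun e => (max 0 (x (Sum.inr e) - x (Sum.inl v)))^2)))
  / ∑ v, N.deg v * (x (Sum.inl v))^2

/-- The Rayleigh quotient `R⁻`. -/
noncomputable def Rm (x : V ⊕ E → ℝ) : ℝ :=
  (∑ v, (lovOn (N.ρp v) (N.outE v) (fun e => (max 0 (x (Sum.inr e) - x (Sum.inl v)))^2)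
       + lovOn (N.ρm v) (N.inE v) (fun e => (max 0 (x (Sum.inl v) - x (Sum.inr e)))^2)))
  / ∑ v, N.deg v * (x (Sum.inl v))^2

/-- The Rayleigh quotient `R`. -/
noncomputable def Ray (x : V ⊕ E → ℝ) : ℝ := min (N.Rp x) (N.Rm x)

/-- The symmetric Rayleigh quotient `R̄`. -/
noncomputable def RaySym (x : V ⊕ E → ℝ) : ℝ := N.Rp x + N.Rm x

/-- The spectral gap `γ₂` of a polymatroidal network. -/
noncomputable def gap : ℝ :=
  sInf {r | ∃ x : V ⊕ E → ℝ, (∑ v, N.deg v * x (Sum.inl v)) = 0 ∧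
    (0 < ∑ v, N.deg v * (x (Sum.inl v))^2) ∧ r = N.Ray x}

end PolyNet

section LovaszExtension

variable {E : Type*} {f : Set E → ℝ} {D : Set E}

/-- For a monotone set function, the level-set profile defining the Lovász extension is antitone. -/
theorem antitone_levelSet (hmono : ∀ A B, A ⊆ B → B ⊆ D → f A ≤ f B) (y : E → ℝ) :
    Antitone fun θ : ℝ => f (D ∩ {e | θ ≤ y e}) := fun _ _ h =>
  hmono _ _ (fun _ he => ⟨he.1, h.trans he.2⟩) Set.inter_subset_left

theorem integrableOn_levelSet [Finite E] (hempty : f ∅ = 0)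
    (hmono : ∀ A B, A ⊆ B → B ⊆ D → f A ≤ f B) (y : E → ℝ) :
    IntegrableOn (fun θ : ℝ => f (D ∩ {e | θ ≤ y e})) (Set.Ioi 0) := by
  obtain ⟨M, hM⟩ := (Set.finite_range y).bddAbove
  have hIcc : IntegrableOn (fun θ : ℝ => f (D ∩ {e | θ ≤ y e})) (Set.Icc 0 M) :=
    (antitone_levelSet hmono y).antitoneOn _ |>.integrableOn_isCompact isCompact_Icc
  refine hIcc.of_forall_sdiff_eq_zero measurableSet_Ioi fun θ hθ => ?_
  have hlt : M < θ := by
    by_contra! h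
    exact hθ.2 ⟨le_of_lt hθ.1, h⟩
  have hset : D ∩ {e | θ ≤ y e} = ∅ := by
    ext e
    have := hM (Set.mem_range_self e)
    simp only [Set.mem_inter_iff, Set.mem_ofPred_eq, Set.mem_empty_iff_false, iff_false, not_and]
    intro _ h
    linarith
  simp only [hset, hempty]

theorem lovOn_nonneg (hnonneg : ∀ A, 0 ≤ f A) (x : E → ℝ) : 0 ≤ lovOn f D x :=
  integral_nonneg fun _ => hnonneg _

/-- The Lovász extension of a monotone function is monotone, positively homogeneous, and translates
by `c * f D` along the constant vector `c`; this is the resulting upper bound. -/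
theorem lovOn_le_mul_add [Finite E] (hnonneg : ∀ A, 0 ≤ f A) (hempty : f ∅ = 0)
    (hmono : ∀ A B, A ⊆ B → B ⊆ D → f A ≤ f B) {x y : E → ℝ} {s c : ℝ} (hs : 0 < s) (hc : 0 ≤ c)
    (hxy : ∀ e, x e ≤ s * y e + c) :
    lovOn f D x ≤ s * lovOn f D y + c * f D := by
  set G : ℝ → ℝ := (Set.Ioi 0).indicator fun θ => f (D ∩ {e | θ ≤ y e}) with hG
  have hGint : Integrable G :=
    (integrableOn_levelSet hempty hmono y).integrable_indicator measurableSet_Ioi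
  have hGs : Integrable fun θ => G ((θ - c) / s) :=
    (hGint.comp_div hs.ne').comp_sub_right c
  have hGval : ∫ θ, G ((θ - c) / s) = s * lovOn f D y := by
    rw [integral_sub_right_eq_self (fun θ => G (θ / s)) c, Measure.integral_comp_div,
      hG, integral_indicator measurableSet_Ioi, abs_of_pos hs, smul_eq_mul, lovOn]
  have hKint : Integrable ((Set.Ioc 0 c).indicator fun _ : ℝ => f D) :=
    (integrableOn_const (by simp)).integrable_indicator measurableSet_Ioc
  have hKval : ∫ θ, (Set.Ioc 0 c).indicator (fun _ : ℝ => f D) θ = c * f D := by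
    rw [integral_indicator measurableSet_Ioc]
    simp [hc]
  rw [← hGval, ← hKval, ← integral_add hGs hKint, lovOn, ← integral_indicator measurableSet_Ioi]
  refine integral_mono
    ((integrableOn_levelSet hempty hmono x).integrable_indicator measurableSet_Ioi)
    (hGs.add hKint) fun θ => ?_
  have hG0 : 0 ≤ G ((θ - c) / s) := Set.indicator_nonneg (fun _ _ => hnonneg _) _
  have hK0 : 0 ≤ (Set.Ioc 0 c).indicator (fun _ : ℝ => f D) θ :=
    Set.indicator_nonneg (fun _ _ => hnonneg _) _
  by_cases hθ : 0 < θ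
  · rw [Set.indicator_of_mem (Set.mem_Ioi.2 hθ)]
    by_cases hθc : θ ≤ c
    · rw [Set.indicator_of_mem (Set.mem_Ioc.2 ⟨hθ, hθc⟩)]
      exact (hmono _ _ Set.inter_subset_left subset_rfl).trans (le_add_of_nonneg_left hG0)
    · refine le_trans ?_ (le_add_of_nonneg_right hK0)
      have hpos : 0 < (θ - c) / s := div_pos (by linarith) hs
      rw [hG, Set.indicator_of_mem (Set.mem_Ioi.2 hpos)]
      refine hmono _ _ (fun e he => ⟨he.1, ?_⟩) Set.inter_subset_left
      have h1 : θ ≤ x e := he.2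
      have h2 := hxy e
      rw [Set.mem_ofPred_eq, div_le_iff₀ hs]
      linarith
  · rw [Set.indicator_of_notMem (by simpa using hθ)]
    exact add_nonneg hG0 hK0

end LovaszExtension

/-- Weighted AM-GM bound for the positive part of a difference of squares, decreasing case. -/
theorem max_sq_sub_sq_le_left {a b t : ℝ} (ha : 0 ≤ a) (ht : 0 < t) :
    max 0 (a ^ 2 - b ^ 2) ≤ (1 + t) * max 0 (a - b) ^ 2 + t⁻¹ * a ^ 2 := by
  have hsq : 0 ≤ t⁻¹ * (t * (a - b) - a) ^ 2 := by positivity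
  have hexp : t⁻¹ * (t * (a - b) - a) ^ 2
      = t * (a - b) ^ 2 - 2 * a * (a - b) + t⁻¹ * a ^ 2 := by
    field_simp
    ring
  have hta : 0 ≤ t⁻¹ * a ^ 2 := by positivity
  refine max_le (by positivity) ?_
  rcases le_total a b with h | h
  · rw [max_eq_left (by linarith)]
    nlinarith
  · rw [max_eq_right (by linarith)]
    nlinarith [sq_nonneg (a - b)]

/-- Weighted AM-GM bound for the positive part of a difference of squares, increasing case. -/
theorem max_sq_sub_sq_le_right {a b t : ℝ} (ha : 0 ≤ a) (hb : 0 ≤ b) (ht : 0 < t) :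
    max 0 (b ^ 2 - a ^ 2) ≤ (1 + t) * max 0 (b - a) ^ 2 + t⁻¹ * a ^ 2 := by
  have hsq : 0 ≤ t⁻¹ * (t * (b - a) - a) ^ 2 := by positivity
  have hexp : t⁻¹ * (t * (b - a) - a) ^ 2
      = t * (b - a) ^ 2 - 2 * a * (b - a) + t⁻¹ * a ^ 2 := by
    field_simp
    ring
  have hta : 0 ≤ t⁻¹ * a ^ 2 := by positivity
  refine max_le (by positivity) ?_
  rcases le_total b a with h | h
  · nlinarith [mul_nonneg (by linarith : 0 ≤ 1 + t) (sq_nonneg (max 0 (b - a)))]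
  · rw [max_eq_right (by linarith)]
    nlinarith

/-- Optimizing the parameter `t` in a bound `P ≤ (1 + t) Q + t⁻¹ S`. -/
theorem div_le_of_forall_le_mul_add {P Q S : ℝ} (hS : 0 < S) (hQ : 0 ≤ Q)
    (h : ∀ t : ℝ, 0 < t → P ≤ (1 + t) * Q + t⁻¹ * S) :
    P / S ≤ 8 * (Q / S + √(Q / S)) := by
  have hR : 0 ≤ Q / S := div_nonneg hQ hS.le
  have hdiv : ∀ t : ℝ, 0 < t → P / S ≤ (1 + t) * (Q / S) + t⁻¹ := fun t ht => by
    rw [div_le_iff₀ hS, add_mul, mul_assoc, div_mul_cancel₀ _ hS.ne']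
    exact h t ht
  rcases hR.eq_or_lt with h0 | h0
  · rw [← h0] at hdiv ⊢
    simp only [mul_zero, zero_add, Real.sqrt_zero] at hdiv ⊢
    refine le_of_forall_pos_le_add fun ε hε => ?_
    simpa using hdiv ε⁻¹ (inv_pos.2 hε)
  · have hr : 0 < √(Q / S) := Real.sqrt_pos.2 h0
    have hrr : √(Q / S) * √(Q / S) = Q / S := Real.mul_self_sqrt hR
    have hb := hdiv (√(Q / S))⁻¹ (inv_pos.2 hr)
    have hinv : (√(Q / S))⁻¹ * (Q / S) = √(Q / S) := by
      nth_rewrite 2 [← hrr]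
      field_simp
    rw [inv_inv, add_mul, hinv] at hb
    linarith

/-- Square-root bound for the `ℓ₁`-type quotient of the squared vector in terms
of the Rayleigh quotients, for nonnegative `z` with positive denominator. -/
theorem lovasz_sqrt_rayleigh_bound {V E : Type*} [Fintype V] [Fintype E] (N : PolyNet V E)
    (z : V ⊕ E → ℝ) (hz : ∀ i, 0 ≤ z i)
    (hpos : 0 < ∑ v, N.deg v * (z (Sum.inl v))^2) :
    (∑ v, (lovOn (N.ρp v) (N.outE v)
            (fun e => max 0 ((z (Sum.inl v))^2 - (z (Sum.inr e))^2))
         + lovOn (N.ρm v) (N.inE v)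
            (fun e => max 0 ((z (Sum.inr e))^2 - (z (Sum.inl v))^2))))
        / (∑ v, N.deg v * (z (Sum.inl v))^2)
      ≤ 8 * (N.Rp z + Real.sqrt (N.Rp z)) ∧
    (∑ v, (lovOn (N.ρp v) (N.outE v)
            (fun e => max 0 ((z (Sum.inr e))^2 - (z (Sum.inl v))^2))
         + lovOn (N.ρm v) (N.inE v)
            (fun e => max 0 ((z (Sum.inl v))^2 - (z (Sum.inr e))^2))))
        / (∑ v, N.deg v * (z (Sum.inl v))^2)
      ≤ 8 * (N.Rm z + Real.sqrt (N.Rm z)) := by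
  refine ⟨div_le_of_forall_le_mul_add hpos
      (Finset.sum_nonneg fun v _ => add_nonneg (lovOn_nonneg (N.ρp_nonneg v) _)
        (lovOn_nonneg (N.ρm_nonneg v) _)) fun t ht => ?_,
    div_le_of_forall_le_mul_add hpos
      (Finset.sum_nonneg fun v _ => add_nonneg (lovOn_nonneg (N.ρp_nonneg v) _)
        (lovOn_nonneg (N.ρm_nonneg v) _)) fun t ht => ?_⟩
  all_goals
    rw [Finset.mul_sum, Finset.mul_sum, ← Finset.sum_add_distrib]
    refine Finset.sum_le_sum fun v _ => ?_
    have hs : 0 < 1 + t := by linarith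
    have hc : 0 ≤ t⁻¹ * z (Sum.inl v) ^ 2 := by positivity
    have hdec : ∀ e, max 0 (z (Sum.inl v) ^ 2 - z (Sum.inr e) ^ 2) ≤
        (1 + t) * max 0 (z (Sum.inl v) - z (Sum.inr e)) ^ 2 + t⁻¹ * z (Sum.inl v) ^ 2 :=
      fun e => max_sq_sub_sq_le_left (hz _) ht
    have hinc : ∀ e, max 0 (z (Sum.inr e) ^ 2 - z (Sum.inl v) ^ 2) ≤
        (1 + t) * max 0 (z (Sum.inr e) - z (Sum.inl v)) ^ 2 + t⁻¹ * z (Sum.inl v) ^ 2 :=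
      fun e => max_sq_sub_sq_le_right (hz _) (hz _) ht
    rw [PolyNet.deg]
  · have hp := lovOn_le_mul_add (N.ρp_nonneg v) (N.ρp_empty v) (N.ρp_mono v) hs hc hdec
    have hm := lovOn_le_mul_add (N.ρm_nonneg v) (N.ρm_empty v) (N.ρm_mono v) hs hc hinc
    simp only [PolyNet.outE, PolyNet.inE]
    linarith
  · have hp := lovOn_le_mul_add (N.ρp_nonneg v) (N.ρp_empty v) (N.ρp_mono v) hs hc hinc
    have hm := lovOn_le_mul_add (N.ρm_nonneg v) (N.ρm_empty v) (N.ρm_mono v) hs hc hdec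
    simp only [PolyNet.outE, PolyNet.inE]
    linarith
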